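/- Let A, B ⊆ ℝ be Borel sets whose product A × B ⊆ ℝ² has Hausdorff dimension HD(A × B) > 1. Then for Lebesgue-almost every λ ∈ ℝ, the set A ⊖ λB := {x − λy : x ∈ A, y ∈ B} has positive one-dimensional Lebesgue outer measure; equivalently, for almost every λ, the set of parameters t ∈ ℝ for which A ∩ (λB + t) ≠ ∅ has positive Lebesgue outer measure (where λB + t := {λy + t : y ∈ B}). -/

import Mathlib

open Set MeasureTheory

open scoped ENNReal Topology
open Filter

theorem exists_isCompact_subset_range_le_measure {X : Type*} [TopologicalSpace X]
    [MeasurableSpace X] {μ : Measure X} [μ.OuterRegular] {f : (ℕ → ℕ) → X} (hf : Continuous f)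
    {c : ℝ≥0∞} (hc : c < μ (range f)) : ∃ K ⊆ range f, IsCompact K ∧ c ≤ μ K := by
  have step (T : {T : Set (ℕ → ℕ) // c < μ (f '' T)}) (k : ℕ) :
      ∃ m, c < μ (f '' (T.1 ∩ {σ | σ k ≤ m})) := by
    have hmono : Monotone fun m : ℕ => f '' (T.1 ∩ {σ | σ k ≤ m}) := fun a b hab =>
      image_mono (inter_subset_inter_right _ fun σ (hσ : σ k ≤ a) => hσ.trans hab)
    have hU : ⋃ m : ℕ, f '' (T.1 ∩ {σ | σ k ≤ m}) = f '' T.1 := by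
      rw [← image_iUnion, ← inter_iUnion]
      congr 1
      exact inter_eq_left.2 fun σ _ => mem_iUnion.2 ⟨σ k, le_refl (σ k)⟩
    have := T.2
    rw [← hU, hmono.measure_iUnion, lt_iSup_iff] at this
    exact this
  choose m hm using step
  let T : ℕ → {T : Set (ℕ → ℕ) // c < μ (f '' T)} := fun k =>
    Nat.rec ⟨univ, by rwa [image_univ]⟩ (fun k T => ⟨T.1 ∩ {σ | σ k ≤ m T k}, hm T k⟩) k
  let N : ℕ → ℕ := fun k => m (T k) k
  have hT (k : ℕ) : (T k).1 ⊆ {σ | ∀ i < k, σ i ≤ N i} := by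
    induction k with
    | zero => simp
    | succ k ih =>
      rintro σ ⟨h1, h2⟩ i hi
      rcases Nat.lt_succ_iff_lt_or_eq.1 hi with h | rfl
      exacts [ih h1 i h, h2]
  have hC : IsCompact (Set.univ.pi fun i => Iic (N i)) :=
    isCompact_univ_pi fun i => (finite_Iic (N i)).isCompact
  refine ⟨_, image_subset_range f _, hC.image hf, ?_⟩
  rw [Set.measure_eq_iInf_isOpen]
  refine le_iInf₂ fun V hV => le_iInf fun hVo => ?_
  obtain ⟨k, hk⟩ : ∃ k, {σ | ∀ i < k, σ i ≤ N i} ⊆ f ⁻¹' V := by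
    let _ : MetricSpace (ℕ → ℕ) := PiNat.metricSpaceNatNat
    obtain ⟨δ, hδ, hδV⟩ :=
      hC.exists_cthickening_subset_open (hVo.preimage hf) (image_subset_iff.1 hV)
    obtain ⟨k, hk⟩ := exists_pow_lt_of_lt_one hδ (by norm_num : (1 / 2 : ℝ) < 1)
    refine ⟨k, fun σ hσ => hδV ?_⟩
    refine Metric.mem_cthickening_of_dist_le σ (fun i => min (σ i) (N i)) _ _
      (fun i _ => mem_Iic.2 (min_le_right _ _)) (le_trans ?_ hk.le)
    exact PiNat.mem_cylinder_iff_dist_le.1 fun i hi => (min_eq_left (hσ i hi)).symm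
  exact (T k).2.le.trans (measure_mono (image_subset_iff.2 ((hT k).trans hk)))

theorem MeasureTheory.AnalyticSet.nullMeasurableSet {X : Type*} [TopologicalSpace X] [T2Space X]
    [MeasurableSpace X] [OpensMeasurableSpace X] {μ : Measure X} [IsFiniteMeasure μ]
    [μ.OuterRegular] {s : Set X} (hs : AnalyticSet s) : NullMeasurableSet s μ := by
  rw [AnalyticSet] at hs
  rcases hs with rfl | ⟨f, hf, rfl⟩
  · exact MeasurableSet.empty.nullMeasurableSet
  rcases eq_zero_or_pos (μ (range f)) with h0 | h0
  · exact NullMeasurableSet.of_null h0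
  obtain ⟨u, -, hu, hlim⟩ := exists_seq_strictMono_tendsto' h0
  choose K hKs hK hKu using fun n => exists_isCompact_subset_range_le_measure hf (hu n).2
  refine NullMeasurableSet.congr
    (MeasurableSet.iUnion fun n => (hK n).measurableSet).nullMeasurableSet
    (ae_eq_of_subset_of_measure_ge (iUnion_subset hKs) ?_ ?_ (measure_ne_top _ _))
  · exact le_of_tendsto' hlim fun n => (hKu n).trans (measure_mono (subset_iUnion K n))
  · exact (MeasurableSet.iUnion fun n => (hK n).measurableSet).nullMeasurableSet

section Frostman

variable {X ι : Type*} [MeasurableSpace X]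

/-- The densities supported on `V` whose mass on every cell `D n ⁻¹' {i}` is at most `a n`. -/
def frostmanDensities (m : Measure X) (D : ℕ → X → ι) (a : ℕ → ℝ≥0∞) (V : Set X) :
    Set (X → ℝ≥0∞) :=
  {h | Measurable h ∧ (∀ p ∉ V, h p = 0) ∧ ∀ n i, ∫⁻ p in D n ⁻¹' {i}, h p ∂m ≤ a n}

/-- The largest mass that a density in `frostmanDensities m D a V` gives to a cell. -/
noncomputable def frostmanMass (m : Measure X) (D : ℕ → X → ι) (a : ℕ → ℝ≥0∞) (V : Set X) (n : ℕ)
    (i : ι) : ℝ≥0∞ :=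
  ⨆ h ∈ frostmanDensities m D a V, ∫⁻ p in D n ⁻¹' {i}, h p ∂m

open Classical in
/-- The cells of level `n + k` inside the cell `i` of level `n` that are saturated while none of
the intermediate cells is. -/
noncomputable def saturatedCells (m : Measure X) (D : ℕ → X → ι) (a : ℕ → ℝ≥0∞) (V : Set X)
    (ch : ι → Finset ι) : ℕ → ℕ → ι → Finset ι
  | 0, n, i => if a n ≤ frostmanMass m D a V n i then {i} else ∅
  | k + 1, n, i => if a n ≤ frostmanMass m D a V n i then ∅ else
      (ch i).biUnion (saturatedCells m D a V ch k (n + 1))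

variable {m : Measure X} {D : ℕ → X → ι} {a : ℕ → ℝ≥0∞} {V : Set X} {ch : ι → Finset ι}

theorem le_frostmanMass {h : X → ℝ≥0∞} (hh : h ∈ frostmanDensities m D a V) (n : ℕ) (i : ι) :
    ∫⁻ p in D n ⁻¹' {i}, h p ∂m ≤ frostmanMass m D a V n i :=
  le_iSup₂_of_le h hh le_rfl

theorem frostmanMass_le (n : ℕ) (i : ι) : frostmanMass m D a V n i ≤ a n :=
  iSup₂_le fun _ hh => hh.2.2 n i

/-- Densities chosen on the children of a cell can be glued to a single density. -/
theorem sum_le_frostmanMass_of_lt (hD : ∀ n i, MeasurableSet (D n ⁻¹' {i}))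
    (hch : ∀ n p i, D n p = i ↔ D (n + 1) p ∈ ch i) (ha : Antitone a) (ha' : ∀ n, a n ≠ ∞)
    {n : ℕ} {i : ι} (hlt : frostmanMass m D a V n i < a n) :
    ∑ j ∈ ch i, frostmanMass m D a V (n + 1) j ≤ frostmanMass m D a V n i := by
  have key (h : ι → X → ℝ≥0∞) (hh : ∀ j, h j ∈ frostmanDensities m D a V) :
      ∑ j ∈ ch i, ∫⁻ p in D (n + 1) ⁻¹' {j}, h j p ∂m ≤ frostmanMass m D a V n i := by
    set σ := ∑ j ∈ ch i, ∫⁻ p in D (n + 1) ⁻¹' {j}, h j p ∂m with hσ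
    have hσtop : σ ≠ ∞ := ENNReal.sum_ne_top.2 fun j _ =>
      ((hh j).2.2 (n + 1) j).trans_lt (ha' _).lt_top |>.ne
    let g : X → ℝ≥0∞ := fun p => ∑ j ∈ ch i, (D (n + 1) ⁻¹' {j}).indicator (h j) p
    have hind (j : ι) : Measurable ((D (n + 1) ⁻¹' {j}).indicator (h j)) :=
      (hh j).1.indicator (hD _ _)
    have hg : Measurable g := Finset.measurable_fun_sum _ fun j _ => hind j
    have hgσ : ∫⁻ p, g p ∂m = σ := by
      simp only [g, hσ]
      rw [lintegral_finsetSum _ fun j _ => hind j]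
      exact Finset.sum_congr rfl fun j _ => lintegral_indicator (hD _ _) _
    have hgi : ∫⁻ p in D n ⁻¹' {i}, g p ∂m = σ := by
      rw [← hgσ, setLIntegral_eq_of_support_subset]
      intro p hp
      obtain ⟨j, hj, hpj⟩ := Finset.exists_ne_zero_of_sum_ne_zero hp
      have : D (n + 1) p = j := by
        by_contra hne
        exact hpj (indicator_of_notMem (s := D (n + 1) ⁻¹' {j}) hne _)
      exact (hch n p i).2 (this ▸ hj)
    have main (θ : ℝ≥0∞) (h1 : θ ≤ 1) (hθ : θ * σ ≤ a n) :
        θ * σ ≤ frostmanMass m D a V n i := by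
      have hmem : (fun p => θ * g p) ∈ frostmanDensities m D a V := by
        refine ⟨hg.const_mul θ, fun p hp => ?_, fun k l => ?_⟩
        · have : g p = 0 := Finset.sum_eq_zero fun j _ => by
            by_cases hpj : p ∈ D (n + 1) ⁻¹' {j}
            · rw [indicator_of_mem hpj, (hh j).2.1 p hp]
            · exact indicator_of_notMem hpj _
          simp [this]
        · rw [lintegral_const_mul _ hg]
          rcases le_or_gt k n with hk | hk
          · calc θ * ∫⁻ p in D k ⁻¹' {l}, g p ∂m ≤ θ * σ := by
                  rw [← hgσ]; exact mul_le_mul_right (setLIntegral_le_lintegral _ _) _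
              _ ≤ a k := hθ.trans (ha hk)
          · have hdesc (r : ℕ) : ∀ p q, D (n + 1 + r) p = D (n + 1 + r) q →
                D (n + 1) p = D (n + 1) q := by
              induction r with
              | zero => simp
              | succ r ih =>
                intro p q hpq
                refine ih p q ?_
                rw [hch (n + 1 + r) p]
                have := (hch (n + 1 + r) q _).1 rfl
                rw [← add_assoc] at hpq
                rwa [hpq]
            obtain ⟨r, rfl⟩ := Nat.exists_eq_add_of_le (Nat.succ_le_of_lt hk)
            have : ∃ j₀, ∀ p ∈ D (n + 1 + r) ⁻¹' {l}, g p ≤ h j₀ p := by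
              rcases (D (n + 1 + r) ⁻¹' {l}).eq_empty_or_nonempty with he | ⟨q, hq⟩
              · exact ⟨l, by simp [he]⟩
              refine ⟨D (n + 1) q, fun p hp => ?_⟩
              have hpq : D (n + 1) p = D (n + 1) q :=
                hdesc r p q (hp.trans hq.symm)
              have hz : ∀ j ∈ ch i, j ≠ D (n + 1) q →
                  (D (n + 1) ⁻¹' {j}).indicator (h j) p = 0 := fun j _ hj =>
                indicator_of_notMem (fun hp' => hj (hp'.symm.trans hpq)) _
              by_cases hq' : D (n + 1) q ∈ ch i
              · simp only [g]
                rw [Finset.sum_eq_single_of_mem _ hq' hz]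
                exact indicator_le_self _ _ _
              · simp only [g]
                rw [Finset.sum_eq_zero fun j hj => hz j hj fun e => hq' (e ▸ hj)]
                exact zero_le
            obtain ⟨j₀, hj₀⟩ := this
            calc θ * ∫⁻ p in D (n + 1 + r) ⁻¹' {l}, g p ∂m
                ≤ 1 * ∫⁻ p in D (n + 1 + r) ⁻¹' {l}, h j₀ p ∂m := by
                  exact mul_le_mul' h1 (setLIntegral_mono' (hD _ _) hj₀)
              _ ≤ a (n + 1 + r) := by rw [one_mul]; exact (hh j₀).2.2 _ _
      have := le_frostmanMass hmem n i
      rwa [lintegral_const_mul _ hg, hgi] at this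
    rcases le_or_gt σ (a n) with hσa | hσa
    · simpa using main 1 le_rfl (by simpa using hσa)
    · have hσ0 : σ ≠ 0 := (bot_le.trans_lt hσa).ne'
      have := main (a n / σ) (ENNReal.div_le_of_le_mul (by simpa using hσa.le))
        (ENNReal.div_mul_cancel hσ0 hσtop).le
      rw [ENNReal.div_mul_cancel hσ0 hσtop] at this
      exact absurd this hlt.not_ge
  rcases isEmpty_or_nonempty ι with hι | hι
  · simp [Finset.eq_empty_of_isEmpty (ch i)]
  refine ENNReal.le_of_forall_pos_le_add fun ε hε _ => ?_
  set δ : ℝ≥0∞ := ε / ((ch i).card + 1) with hδ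
  have hδ0 : δ ≠ 0 := by
    rw [hδ]; exact ENNReal.div_ne_zero.2 ⟨by exact_mod_cast hε.ne', by finiteness⟩
  have hex (j : ι) : ∃ h ∈ frostmanDensities m D a V,
      frostmanMass m D a V (n + 1) j ≤ ∫⁻ p in D (n + 1) ⁻¹' {j}, h p ∂m + δ := by
    by_contra! hcon
    have h0 : (fun _ => 0) ∈ frostmanDensities m D a V := ⟨measurable_const, by simp, by simp⟩
    have hfin : frostmanMass m D a V (n + 1) j ≠ ∞ :=
      (frostmanMass_le _ _).trans_lt (ha' _).lt_top |>.ne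
    have hpos : frostmanMass m D a V (n + 1) j ≠ 0 := (bot_le.trans_lt (hcon _ h0)).ne'
    have : frostmanMass m D a V (n + 1) j ≤ frostmanMass m D a V (n + 1) j - δ :=
      iSup₂_le fun h hh => ENNReal.le_sub_of_add_le_right
        (fun e => by have := hcon h hh; simp [e] at this) (hcon h hh).le
    exact this.not_gt (ENNReal.sub_lt_self hfin hpos hδ0)
  choose h hh hle using hex
  calc ∑ j ∈ ch i, frostmanMass m D a V (n + 1) j
      ≤ ∑ j ∈ ch i, (∫⁻ p in D (n + 1) ⁻¹' {j}, h j p ∂m + δ) := Finset.sum_le_sum fun j _ => hle j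
    _ = ∑ j ∈ ch i, ∫⁻ p in D (n + 1) ⁻¹' {j}, h j p ∂m + (ch i).card * δ := by
      rw [Finset.sum_add_distrib, Finset.sum_const, nsmul_eq_mul]
    _ ≤ frostmanMass m D a V n i + ε := by
      gcongr
      · exact key h hh
      · calc ((ch i).card : ℝ≥0∞) * δ ≤ ((ch i).card + 1) * δ := by gcongr; exact le_self_add
          _ = ε := ENNReal.mul_div_cancel (by simp) (by finiteness)

theorem sum_saturatedCells_le (hD : ∀ n i, MeasurableSet (D n ⁻¹' {i}))
    (hch : ∀ n p i, D n p = i ↔ D (n + 1) p ∈ ch i) (ha : Antitone a) (ha' : ∀ n, a n ≠ ∞)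
    (K n : ℕ) (i : ι) :
    ∑ k ∈ Finset.range K, ((saturatedCells m D a V ch k n i).card * a (n + k)) ≤
      frostmanMass m D a V n i := by
  classical
  induction K generalizing n i with
  | zero => simp
  | succ K ih =>
    rw [Finset.sum_range_succ']
    by_cases hs : a n ≤ frostmanMass m D a V n i
    · simp [saturatedCells, hs]
    · calc _ = ∑ k ∈ Finset.range K,
            (((ch i).biUnion (saturatedCells m D a V ch k (n + 1))).card * a (n + 1 + k)) := by
            simp [saturatedCells, hs, add_assoc, add_comm 1]
        _ ≤ ∑ k ∈ Finset.range K, ∑ j ∈ ch i,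
            ((saturatedCells m D a V ch k (n + 1) j).card * a (n + 1 + k)) := by
            gcongr with k
            rw [← Finset.sum_mul]
            gcongr
            exact_mod_cast Finset.card_biUnion_le
        _ = ∑ j ∈ ch i, ∑ k ∈ Finset.range K,
            ((saturatedCells m D a V ch k (n + 1) j).card * a (n + 1 + k)) := Finset.sum_comm
        _ ≤ ∑ j ∈ ch i, frostmanMass m D a V (n + 1) j := Finset.sum_le_sum fun j _ => ih _ _
        _ ≤ _ := sum_le_frostmanMass_of_lt hD hch ha ha' (not_le.1 hs)

theorem exists_mem_saturatedCells (hch : ∀ n p i, D n p = i ↔ D (n + 1) p ∈ ch i) {p : X}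
    (k n : ℕ) (hk : a (n + k) ≤ frostmanMass m D a V (n + k) (D (n + k) p)) :
    ∃ l, D (n + l) p ∈ saturatedCells m D a V ch l n (D n p) := by
  induction k generalizing n with
  | zero =>
    refine ⟨0, ?_⟩
    rw [saturatedCells, if_pos (show a n ≤ frostmanMass m D a V n (D n p) from hk)]
    exact Finset.mem_singleton_self _
  | succ k ih =>
    by_cases hs : a n ≤ frostmanMass m D a V n (D n p)
    · exact ⟨0, by rw [saturatedCells, if_pos hs]; exact Finset.mem_singleton_self _⟩
    obtain ⟨l, hl⟩ := ih (n + 1) (by rwa [add_assoc, add_comm 1])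
    refine ⟨l + 1, ?_⟩
    simp only [saturatedCells, hs, if_false, Finset.mem_biUnion]
    exact ⟨D (n + 1) p, (hch n p _).1 rfl, by rwa [add_comm l, ← add_assoc]⟩

end Frostman

section Dyadic

/-- The index of the half-open dyadic square of side `2 ^ (-n)` that contains `p`. -/
noncomputable def dyadicIndex (n : ℕ) (p : ℝ × ℝ) : ℤ × ℤ := (⌊2 ^ n * p.1⌋, ⌊2 ^ n * p.2⌋)

/-- The indices of the four dyadic subsquares of half the side of the dyadic square of index `i`. -/
def dyadicChildren (i : ℤ × ℤ) : Finset (ℤ × ℤ) :=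
  {2 * i.1, 2 * i.1 + 1} ×ˢ {2 * i.2, 2 * i.2 + 1}

theorem floor_two_pow_mul_eq_iff (n : ℕ) (x : ℝ) (i : ℤ) :
    ⌊2 ^ n * x⌋ = i ↔ ⌊2 ^ (n + 1) * x⌋ = 2 * i ∨ ⌊2 ^ (n + 1) * x⌋ = 2 * i + 1 := by
  simp only [Int.floor_eq_iff, pow_succ']
  push_cast
  constructor
  · rintro ⟨h1, h2⟩
    rcases lt_or_ge (2 * 2 ^ n * x) (2 * i + 1) with h | h
    · exact Or.inl ⟨by linarith, by linarith⟩
    · exact Or.inr ⟨by linarith, by linarith⟩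
  · rintro (⟨h1, h2⟩ | ⟨h1, h2⟩) <;> constructor <;> linarith

theorem dyadicIndex_eq_iff (n : ℕ) (p : ℝ × ℝ) (i : ℤ × ℤ) :
    dyadicIndex n p = i ↔ dyadicIndex (n + 1) p ∈ dyadicChildren i := by
  simp only [dyadicIndex, dyadicChildren, Finset.mem_product, Finset.mem_insert,
    Finset.mem_singleton, Prod.ext_iff, floor_two_pow_mul_eq_iff n]

theorem measurable_dyadicIndex (n : ℕ) : Measurable (dyadicIndex n) := by
  unfold dyadicIndex
  fun_prop

theorem measurableSet_dyadicIndex_preimage (n : ℕ) (i : ℤ × ℤ) :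
    MeasurableSet (dyadicIndex n ⁻¹' {i}) :=
  measurable_dyadicIndex n (measurableSet_singleton i)

theorem dyadicIndex_preimage (n : ℕ) (i : ℤ × ℤ) :
    dyadicIndex n ⁻¹' {i} =
      Ico (i.1 / 2 ^ n : ℝ) ((i.1 + 1) / 2 ^ n) ×ˢ Ico (i.2 / 2 ^ n : ℝ) ((i.2 + 1) / 2 ^ n) := by
  have h (x : ℝ) (k : ℤ) : ⌊2 ^ n * x⌋ = k ↔ x ∈ Ico (k / 2 ^ n : ℝ) ((k + 1) / 2 ^ n) := by
    rw [Int.floor_eq_iff, mem_Ico, div_le_iff₀' (by positivity), lt_div_iff₀' (by positivity)]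
  ext p
  simp only [mem_preimage, mem_singleton_iff, dyadicIndex, Prod.ext_iff, h, mem_prod]

theorem edist_le_of_dyadicIndex_eq {n : ℕ} {p q : ℝ × ℝ} (h : dyadicIndex n p = dyadicIndex n q) :
    edist p q ≤ 2⁻¹ ^ n := by
  have key {x y : ℝ} (h : ⌊2 ^ n * x⌋ = ⌊2 ^ n * y⌋) : dist x y ≤ 2⁻¹ ^ n := by
    have := Int.abs_sub_lt_one_of_floor_eq_floor h
    rw [← mul_sub, abs_mul, abs_of_pos (by positivity)] at this
    rw [Real.dist_eq, inv_pow, inv_eq_one_div, le_div_iff₀' (by positivity)]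
    exact this.le
  have := Prod.ext_iff.1 h
  have hd : dist p q ≤ 2⁻¹ ^ n := max_le (key this.1) (key this.2)
  rw [edist_dist]
  refine (ENNReal.ofReal_le_ofReal hd).trans_eq ?_
  rw [ENNReal.ofReal_pow (by norm_num), ENNReal.ofReal_inv_of_pos (by norm_num)]
  norm_num

theorem ediam_dyadicIndex_preimage_le (n : ℕ) (i : ℤ × ℤ) :
    Metric.ediam (dyadicIndex n ⁻¹' {i}) ≤ 2⁻¹ ^ n :=
  Metric.ediam_le fun _ hp _ hq => edist_le_of_dyadicIndex_eq (hp.trans (Eq.symm hq))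

theorem volume_dyadicIndex_preimage (n : ℕ) (i : ℤ × ℤ) :
    volume (dyadicIndex n ⁻¹' {i}) = (2⁻¹ ^ n) ^ 2 := by
  have h (k : ℤ) : volume (Ico (k / 2 ^ n : ℝ) ((k + 1) / 2 ^ n)) = 2⁻¹ ^ n := by
    rw [Real.volume_Ico, ← sub_div, add_sub_cancel_left, one_div, ← inv_pow,
      ENNReal.ofReal_pow (by norm_num), ENNReal.ofReal_inv_of_pos (by norm_num)]
    norm_num
  rw [dyadicIndex_preimage, Measure.volume_eq_prod, Measure.prod_prod, h, h, sq]

theorem exists_dyadicIndex_preimage_subset {V : Set (ℝ × ℝ)} (hV : IsOpen V) {p : ℝ × ℝ}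
    (hp : p ∈ V) : ∃ n, dyadicIndex n ⁻¹' {dyadicIndex n p} ⊆ V := by
  obtain ⟨ε, hε, hεV⟩ := EMetric.isOpen_iff.1 hV p hp
  obtain ⟨n, hn⟩ := ENNReal.exists_inv_two_pow_lt hε.ne'
  exact ⟨n, fun q hq => hεV ((edist_le_of_dyadicIndex_eq hq).trans_lt hn)⟩

theorem antitone_inv_two_pow_rpow {s : ℝ} (hs : 0 ≤ s) :
    Antitone fun n : ℕ => ((2⁻¹ : ℝ≥0∞) ^ n) ^ s := fun _ _ h =>
  ENNReal.rpow_le_rpow (pow_le_pow_of_le_one zero_le (by simp) h) hs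

theorem inv_two_pow_rpow_ne_top {s : ℝ} (hs : 0 ≤ s) (n : ℕ) :
    ((2⁻¹ : ℝ≥0∞) ^ n) ^ s ≠ ∞ :=
  ENNReal.rpow_ne_top_of_nonneg hs (by simp)

theorem le_frostmanMass_of_subset {s : ℝ} (hs : 0 ≤ s) (hs2 : s ≤ 2) {V : Set (ℝ × ℝ)} {n : ℕ}
    {i : ℤ × ℤ} (h : dyadicIndex n ⁻¹' {i} ⊆ V) :
    ((2⁻¹ : ℝ≥0∞) ^ n) ^ s ≤
      frostmanMass volume dyadicIndex (fun n => ((2⁻¹ : ℝ≥0∞) ^ n) ^ s) V n i := by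
  set r : ℕ → ℝ≥0∞ := fun n => 2⁻¹ ^ n with hr
  have hr0 (n : ℕ) : r n ≠ 0 := by simp [hr]
  have hrt (n : ℕ) : r n ≠ ∞ := by simp [hr]
  set c : ℝ≥0∞ := r n ^ (s - 2) with hc
  have hcr (k : ℕ) : r k ^ (s - 2) * (r k) ^ 2 = r k ^ s := by
    rw [← ENNReal.rpow_natCast, ← ENNReal.rpow_add _ _ (hr0 k) (hrt k)]
    norm_num
  have hint (k : ℕ) (j : ℤ × ℤ) :
      ∫⁻ p in dyadicIndex k ⁻¹' {j}, (dyadicIndex n ⁻¹' {i}).indicator (fun _ => c) p =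
        c * volume (dyadicIndex n ⁻¹' {i} ∩ dyadicIndex k ⁻¹' {j}) := by
    rw [lintegral_indicator_const (measurableSet_dyadicIndex_preimage n i),
      Measure.restrict_apply (measurableSet_dyadicIndex_preimage n i)]
  have hmem : (dyadicIndex n ⁻¹' {i}).indicator (fun _ => c) ∈
      frostmanDensities volume dyadicIndex (fun n => ((2⁻¹ : ℝ≥0∞) ^ n) ^ s) V := by
    refine ⟨measurable_const.indicator (measurableSet_dyadicIndex_preimage n i),
      fun p hp => indicator_of_notMem (fun hp' => hp (h hp')) _, fun k j => ?_⟩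
    rw [hint]
    rcases le_total k n with hk | hk
    · calc c * volume (dyadicIndex n ⁻¹' {i} ∩ dyadicIndex k ⁻¹' {j})
          ≤ c * (r n) ^ 2 := by
            gcongr
            exact (measure_mono inter_subset_left).trans_eq (volume_dyadicIndex_preimage n i)
        _ = r n ^ s := hcr n
        _ ≤ r k ^ s := antitone_inv_two_pow_rpow hs hk
    · calc c * volume (dyadicIndex n ⁻¹' {i} ∩ dyadicIndex k ⁻¹' {j})
          ≤ r k ^ (s - 2) * (r k) ^ 2 := by
            refine mul_le_mul' ?_ ((measure_mono inter_subset_right).trans_eq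
              (volume_dyadicIndex_preimage k j))
            rw [hc, show s - 2 = -(2 - s) by ring, ENNReal.rpow_neg, ENNReal.rpow_neg]
            exact ENNReal.inv_le_inv.2 <| ENNReal.rpow_le_rpow (z := 2 - s)
              (pow_le_pow_of_le_one zero_le (by simp) hk) (by linarith)
        _ = r k ^ s := hcr k
  refine le_trans (le_of_eq ?_) (le_frostmanMass hmem n i)
  rw [hint, inter_self, volume_dyadicIndex_preimage, ← hcr n]

theorem hausdorffMeasure_eq_zero_of_frostmanMass_le {s : ℝ} (hs : 0 < s) (hs2 : s ≤ 2)
    {E : Set (ℝ × ℝ)} {i : ℤ × ℤ} (hE : E ⊆ dyadicIndex 0 ⁻¹' {i})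
    (h : ∀ ε : ℝ≥0∞, ε ≠ 0 → ∃ V, IsOpen V ∧ E ⊆ V ∧
      frostmanMass volume dyadicIndex (fun n => ((2⁻¹ : ℝ≥0∞) ^ n) ^ s) V 0 i ≤ ε) :
    Measure.hausdorffMeasure s E = 0 := by
  set a : ℕ → ℝ≥0∞ := fun n => ((2⁻¹ : ℝ≥0∞) ^ n) ^ s with ha
  set ε : ℕ → ℝ≥0∞ := fun N => (N : ℝ≥0∞)⁻¹ with hε
  have hε0 (N : ℕ) : ε N ≠ 0 := by simp [hε]
  have hεlim : Tendsto ε atTop (𝓝 0) := ENNReal.tendsto_inv_nat_nhds_zero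
  choose V hVo hEV hV using fun N => h (ε N) (hε0 N)
  let S (N k : ℕ) : Finset (ℤ × ℤ) := saturatedCells volume dyadicIndex a (V N) dyadicChildren k 0 i
  have hcost (N k : ℕ) (j : ℤ × ℤ) : Metric.ediam (dyadicIndex k ⁻¹' {j}) ^ s ≤ a k :=
    ENNReal.rpow_le_rpow (ediam_dyadicIndex_preimage_le k j) hs.le
  have hsum (N : ℕ) : ∑' x : (k : ℕ) × S N k,
      Metric.ediam (dyadicIndex x.1 ⁻¹' {(x.2 : ℤ × ℤ)}) ^ s ≤ ε N := by
    rw [ENNReal.tsum_sigma']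
    calc _ ≤ ∑' k, ((S N k).card * a k) := by
          refine ENNReal.tsum_le_tsum fun k => ?_
          rw [tsum_fintype]
          refine (Finset.sum_le_sum fun (j : S N k) _ => hcost N k j).trans_eq ?_
          simp
      _ ≤ ε N := by
          refine ENNReal.tsum_le_of_sum_range_le fun K => le_trans ?_ (hV N)
          simpa using sum_saturatedCells_le measurableSet_dyadicIndex_preimage dyadicIndex_eq_iff
            (antitone_inv_two_pow_rpow hs.le) (inv_two_pow_rpow_ne_top hs.le) K 0 i
  have hr : Tendsto (fun N => ε N ^ (1 / s)) atTop (𝓝 0) := by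
    have := (ENNReal.continuous_rpow_const (y := 1 / s)).tendsto 0 |>.comp hεlim
    rwa [ENNReal.zero_rpow_of_pos (by positivity)] at this
  refine le_antisymm ((Measure.hausdorffMeasure_le_liminf_tsum s E (fun N => ε N ^ (1 / s)) hr
    (fun N (x : (k : ℕ) × S N k) => dyadicIndex x.1 ⁻¹' {(x.2 : ℤ × ℤ)})
    (Eventually.of_forall fun N x => ?_) (Eventually.of_forall fun N p hp => ?_)).trans
    ((liminf_le_liminf (Eventually.of_forall hsum)).trans_eq hεlim.liminf_eq)) bot_le
  · have := (ENNReal.le_tsum x).trans (hsum N)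
    exact (ENNReal.le_rpow_inv_iff hs).2 this |>.trans_eq (by rw [one_div])
  · obtain ⟨k, hk⟩ := exists_dyadicIndex_preimage_subset (hVo N) (hEV N hp)
    obtain ⟨l, hl⟩ := exists_mem_saturatedCells (m := volume) (a := a) (V := V N) (p := p)
      dyadicIndex_eq_iff k 0 (by simpa using le_frostmanMass_of_subset hs.le hs2 hk)
    rw [show dyadicIndex 0 p = i from hE hp] at hl
    rw [zero_add] at hl
    exact mem_iUnion.2 ⟨⟨l, ⟨_, hl⟩⟩, rfl⟩

end Dyadic

section Energy

theorem setLIntegral_closedEBall_le {s : ℝ} {V : Set (ℝ × ℝ)} {h : ℝ × ℝ → ℝ≥0∞}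
    (hh : h ∈ frostmanDensities volume dyadicIndex (fun n => ((2⁻¹ : ℝ≥0∞) ^ n) ^ s) V)
    (p : ℝ × ℝ) (n : ℕ) :
    ∫⁻ q in {q | edist p q ≤ 2⁻¹ ^ n}, h q ≤ 9 * ((2⁻¹ : ℝ≥0∞) ^ n) ^ s := by
  set i := dyadicIndex n p with hi
  let F : Finset (ℤ × ℤ) := Finset.Icc (i.1 - 1) (i.1 + 1) ×ˢ Finset.Icc (i.2 - 1) (i.2 + 1)
  have hF : F.card = 9 := by
    simp only [F, Finset.card_product, Int.card_Icc]
    ring_nf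
    rfl
  have hnear {x y : ℝ} (hxy : edist x y ≤ 2⁻¹ ^ n) :
      ⌊2 ^ n * y⌋ ∈ Finset.Icc (⌊2 ^ n * x⌋ - 1) (⌊2 ^ n * x⌋ + 1) := by
    have h1 : dist x y ≤ 2⁻¹ ^ n := by
      rw [edist_dist, show (2⁻¹ : ℝ≥0∞) ^ n = ENNReal.ofReal (2⁻¹ ^ n) by
        rw [ENNReal.ofReal_pow (by norm_num), ENNReal.ofReal_inv_of_pos (by norm_num)]
        norm_num] at hxy
      exact (ENNReal.ofReal_le_ofReal_iff (by positivity)).1 hxy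
    rw [Real.dist_eq, inv_pow, inv_eq_one_div, le_div_iff₀' (by positivity),
      ← abs_of_pos (show (0 : ℝ) < 2 ^ n by positivity), ← abs_mul,
      mul_sub, abs_le] at h1
    rw [Finset.mem_Icc, Int.le_floor, ← Int.lt_add_one_iff, Int.floor_lt]
    push_cast
    have h2 := Int.floor_le (2 ^ n * x)
    have h3 := Int.lt_floor_add_one (2 ^ n * x)
    constructor <;> linarith
  have hsub : {q | edist p q ≤ 2⁻¹ ^ n} ⊆ ⋃ j ∈ F, dyadicIndex n ⁻¹' {j} := fun q hq => by
    rw [mem_ofPred_eq, Prod.edist_eq, max_le_iff] at hq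
    exact mem_iUnion₂.2 ⟨dyadicIndex n q, Finset.mem_product.2 ⟨hnear hq.1, hnear hq.2⟩, rfl⟩
  calc ∫⁻ q in {q | edist p q ≤ 2⁻¹ ^ n}, h q
      ≤ ∫⁻ q in ⋃ j ∈ F, dyadicIndex n ⁻¹' {j}, h q := lintegral_mono_set hsub
    _ = ∑ j ∈ F, ∫⁻ q in dyadicIndex n ⁻¹' {j}, h q :=
        lintegral_biUnion_finset
          (fun j _ k _ hjk => (disjoint_singleton.2 hjk).preimage _)
          (fun j _ => measurableSet_dyadicIndex_preimage n j) _
    _ ≤ ∑ j ∈ F, ((2⁻¹ : ℝ≥0∞) ^ n) ^ s := Finset.sum_le_sum fun j _ => hh.2.2 n j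
    _ = 9 * ((2⁻¹ : ℝ≥0∞) ^ n) ^ s := by simp [hF]

theorem inv_le_tsum_of_le_one {d : ℝ≥0∞} (hd : d ≤ 1) :
    d⁻¹ ≤ ∑' n : ℕ, 2 ^ (n + 1) * {x : ℝ≥0∞ | x ≤ 2⁻¹ ^ n}.indicator (1 : ℝ≥0∞ → ℝ≥0∞) d := by
  have hterm (n : ℕ) (h : d ≤ 2⁻¹ ^ n) :
      2 ^ (n + 1) ≤
        ∑' n : ℕ, 2 ^ (n + 1) * {x : ℝ≥0∞ | x ≤ 2⁻¹ ^ n}.indicator (1 : ℝ≥0∞ → ℝ≥0∞) d := by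
    refine le_trans (le_of_eq ?_) (ENNReal.le_tsum n)
    rw [indicator_of_mem (by exact h), Pi.one_apply, mul_one]
  by_contra! hlt
  obtain ⟨N, hN⟩ : ∃ N : ℕ, ¬ d ≤ 2⁻¹ ^ N := by
    by_contra! hall
    refine hlt.ne_top (ENNReal.eq_top_of_forall_nnreal_le fun r => ?_)
    obtain ⟨n, hn⟩ := ENNReal.exists_nat_gt (ENNReal.coe_ne_top (r := r))
    refine (hn.le.trans ?_).trans (hterm n (hall n))
    exact_mod_cast (Nat.lt_two_pow_self.trans
      (Nat.pow_lt_pow_right one_lt_two (Nat.lt_succ_self n))).le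
  obtain ⟨n, hn, hn'⟩ : ∃ n, d ≤ 2⁻¹ ^ n ∧ ¬ d ≤ 2⁻¹ ^ (n + 1) := by
    by_contra! hcon
    exact hN (Nat.rec (by simpa using hd) hcon N)
  refine hlt.not_ge (le_trans ?_ (hterm n hn))
  rw [ENNReal.inv_le_iff_inv_le, ENNReal.inv_pow]
  exact (not_le.1 hn').le

/-- The bound for the `1`-potential of a density whose dyadic squares of side `r` have mass at
most `r ^ s`. -/
noncomputable def potentialBound (s : ℝ) : ℝ≥0∞ :=
  ∑' n : ℕ, 2 ^ (n + 1) * (9 * ((2⁻¹ : ℝ≥0∞) ^ n) ^ s)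

theorem potentialBound_ne_top {s : ℝ} (hs : 1 < s) : potentialBound s ≠ ∞ := by
  have h (n : ℕ) : (2 : ℝ≥0∞) ^ (n + 1) * (9 * ((2⁻¹ : ℝ≥0∞) ^ n) ^ s) =
      18 * ((2⁻¹ : ℝ≥0∞) ^ (s - 1)) ^ n := by
    rw [← ENNReal.rpow_natCast (_ ^ (s - 1)), ← ENNReal.rpow_mul, mul_comm (s - 1),
      ENNReal.rpow_mul, ENNReal.rpow_natCast, ENNReal.rpow_sub _ _ (by simp) (by simp),
      ENNReal.rpow_one, div_eq_mul_inv, ENNReal.inv_pow, inv_inv, ← ENNReal.inv_pow]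
    ring
  unfold potentialBound
  simp_rw [h]
  rw [ENNReal.tsum_mul_left, ENNReal.tsum_geometric]
  refine ENNReal.mul_ne_top (by simp) (ENNReal.inv_ne_top.2 (tsub_pos_of_lt ?_).ne')
  exact ENNReal.rpow_lt_one (ENNReal.inv_lt_one.2 (by norm_num)) (by linarith)

theorem setLIntegral_mul_inv_edist_le {s : ℝ} {V : Set (ℝ × ℝ)} {h : ℝ × ℝ → ℝ≥0∞}
    (hh : h ∈ frostmanDensities volume dyadicIndex (fun n => ((2⁻¹ : ℝ≥0∞) ^ n) ^ s) V)
    {i : ℤ × ℤ} {p : ℝ × ℝ} (hp : p ∈ dyadicIndex 0 ⁻¹' {i}) :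
    ∫⁻ q in dyadicIndex 0 ⁻¹' {i}, h q * (edist p q)⁻¹ ≤ potentialBound s := by
  have hm (n : ℕ) : MeasurableSet {q | edist p q ≤ 2⁻¹ ^ n} :=
    measurableSet_le (by fun_prop) measurable_const
  calc ∫⁻ q in dyadicIndex 0 ⁻¹' {i}, h q * (edist p q)⁻¹
      ≤ ∫⁻ q in dyadicIndex 0 ⁻¹' {i},
          ∑' n : ℕ, 2 ^ (n + 1) * {q | edist p q ≤ 2⁻¹ ^ n}.indicator h q := by
        refine setLIntegral_mono' (measurableSet_dyadicIndex_preimage 0 i) fun q hq => ?_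
        have hd : edist p q ≤ 1 := by
          simpa using edist_le_of_dyadicIndex_eq (n := 0) (hp.trans (Eq.symm hq))
        refine (mul_le_mul_right (inv_le_tsum_of_le_one hd) (h q)).trans_eq ?_
        rw [← ENNReal.tsum_mul_left]
        refine tsum_congr fun n => ?_
        by_cases hn : edist p q ≤ 2⁻¹ ^ n
        · rw [indicator_of_mem (by exact hn), indicator_of_mem (by exact hn), Pi.one_apply, mul_one,
            mul_comm]
        · rw [indicator_of_notMem (by exact hn), indicator_of_notMem (by exact hn)]
          simp
    _ ≤ ∫⁻ q, ∑' n : ℕ, 2 ^ (n + 1) * {q | edist p q ≤ 2⁻¹ ^ n}.indicator h q :=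
        setLIntegral_le_lintegral _ _
    _ = ∑' n : ℕ, 2 ^ (n + 1) * ∫⁻ q in {q | edist p q ≤ 2⁻¹ ^ n}, h q := by
        rw [lintegral_tsum fun n => ((hh.1.indicator (hm n)).const_mul _).aemeasurable]
        refine tsum_congr fun n => ?_
        rw [lintegral_const_mul _ (hh.1.indicator (hm n)), lintegral_indicator (hm n)]
    _ ≤ potentialBound s :=
        ENNReal.tsum_le_tsum fun n => mul_le_mul_right (setLIntegral_closedEBall_le hh p n) _

theorem lintegral_comp_mul_add (f : ℝ → ℝ≥0∞) (hf : Measurable f) {v : ℝ} (hv : v ≠ 0) (x : ℝ) :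
    ENNReal.ofReal |v| * ∫⁻ l, f (x + l * v) = ∫⁻ x', f x' := by
  rw [← lintegral_add_left_eq_self f x, ← lintegral_map (μ := volume) (g := fun l => l * v)
    (f := fun y => f (x + y)) (by fun_prop) (by fun_prop), ← smul_eq_mul,
    ← lintegral_smul_measure, Real.smul_map_volume_mul_right hv]

theorem setLIntegral_comp_mul_add_le (f : ℝ → ℝ≥0∞) (hf : Measurable f) {R : ℝ} (hR : 1 ≤ R)
    {y y' : ℝ} (hy : y' ≠ y) (x : ℝ) :
    ∫⁻ l in Icc (-R) R, f (x + l * (y' - y)) ≤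
      ENNReal.ofReal R * ∫⁻ x', f x' * (edist (x, y) (x', y'))⁻¹ := by
  set v := y' - y with hv
  have hv0 : v ≠ 0 := sub_ne_zero.2 hy
  rw [← lintegral_const_mul _ (by fun_prop), ← lintegral_comp_mul_add _ (by fun_prop) hv0 x,
    ← lintegral_const_mul _ (by fun_prop)]
  refine (setLIntegral_mono' measurableSet_Icc fun l hl => ?_).trans (setLIntegral_le_lintegral _ _)
  have hle : edist (x, y) (x + l * v, y') ≤ ENNReal.ofReal (R * |v|) := by
    rw [Prod.edist_eq, edist_dist, edist_dist]
    refine max_le (ENNReal.ofReal_le_ofReal ?_) (ENNReal.ofReal_le_ofReal ?_)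
    · simp only [Real.dist_eq, sub_add_cancel_left, abs_neg, abs_mul]
      gcongr
      exact abs_le.2 hl
    · simp only [Real.dist_eq]
      rw [abs_sub_comm]
      exact le_mul_of_one_le_left (abs_nonneg _) hR
  have h0 : edist (x, y) (x + l * v, y') ≠ 0 := fun h =>
    hy (Prod.ext_iff.1 (edist_eq_zero.1 h)).2.symm
  calc f (x + l * v) = f (x + l * v) *
        (edist (x, y) (x + l * v, y') * (edist (x, y) (x + l * v, y'))⁻¹) := by
        rw [ENNReal.mul_inv_cancel h0 (edist_ne_top _ _), mul_one]
    _ ≤ f (x + l * v) * (ENNReal.ofReal (R * |v|) * (edist (x, y) (x + l * v, y'))⁻¹) := by gcongr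
    _ = _ := by
        rw [ENNReal.ofReal_mul (by linarith)]
        ring

/-- The `L²` norm of the X-ray transform is controlled by the Riesz energy of order `1`. -/
theorem lintegral_sq_xray_le (h : ℝ × ℝ → ℝ≥0∞) (hh : Measurable h) {R : ℝ} (hR : 1 ≤ R) :
    ∫⁻ l in Icc (-R) R, ∫⁻ t, (∫⁻ y, h (t + l * y, y)) ^ 2 ≤
      ENNReal.ofReal R * ∫⁻ p, h p * ∫⁻ q, h q * (edist p q)⁻¹ := by
  calc ∫⁻ l in Icc (-R) R, ∫⁻ t, (∫⁻ y, h (t + l * y, y)) ^ 2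
      = ∫⁻ l in Icc (-R) R, ∫⁻ t, ∫⁻ y, ∫⁻ y', h (t + l * y, y) * h (t + l * y', y') := by
        refine lintegral_congr fun l => lintegral_congr fun t => ?_
        rw [sq, ← lintegral_mul_const _ (by fun_prop)]
        exact lintegral_congr fun y => (lintegral_const_mul _ (by fun_prop)).symm
    _ = ∫⁻ l in Icc (-R) R, ∫⁻ y, ∫⁻ y', ∫⁻ t, h (t + l * y, y) * h (t + l * y', y') := by
        refine lintegral_congr fun l => ?_
        rw [lintegral_lintegral_swap (by fun_prop)]
        refine lintegral_congr fun y => ?_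
        rw [lintegral_lintegral_swap (by fun_prop)]
    _ = ∫⁻ l in Icc (-R) R, ∫⁻ y, ∫⁻ y', ∫⁻ x, h (x, y) * h (x + l * (y' - y), y') := by
        refine lintegral_congr fun l => lintegral_congr fun y => lintegral_congr fun y' => ?_
        rw [← lintegral_add_right_eq_self _ (-(l * y))]
        refine lintegral_congr fun x => ?_
        ring_nf
    _ = ∫⁻ y, ∫⁻ y', ∫⁻ x, ∫⁻ l in Icc (-R) R, h (x, y) * h (x + l * (y' - y), y') := by
        rw [lintegral_lintegral_swap (by fun_prop)]
        refine lintegral_congr fun y => ?_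
        rw [lintegral_lintegral_swap (by fun_prop)]
        refine lintegral_congr fun y' => ?_
        rw [lintegral_lintegral_swap (by fun_prop)]
    _ ≤ ∫⁻ y, ∫⁻ y', ∫⁻ x, ENNReal.ofReal R *
          (h (x, y) * ∫⁻ x', h (x', y') * (edist (x, y) (x', y'))⁻¹) := by
        refine lintegral_mono fun y => lintegral_mono_ae ?_
        have hne : ∀ᵐ y' : ℝ, y' ≠ y := by simp [ae_iff]
        filter_upwards [hne] with y' hy'
        refine lintegral_mono fun x => ?_
        rw [lintegral_const_mul _ (by fun_prop), mul_left_comm]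
        gcongr
        exact setLIntegral_comp_mul_add_le (fun x' => h (x', y')) (by fun_prop) hR hy' x
    _ = ∫⁻ y, ∫⁻ x, ∫⁻ y', ENNReal.ofReal R *
          (h (x, y) * ∫⁻ x', h (x', y') * (edist (x, y) (x', y'))⁻¹) := by
        refine lintegral_congr fun y => ?_
        rw [lintegral_lintegral_swap (by fun_prop)]
    _ = ∫⁻ y, ∫⁻ x, ENNReal.ofReal R *
          (h (x, y) * ∫⁻ q, h q * (edist (x, y) q)⁻¹) := by
        refine lintegral_congr fun y => lintegral_congr fun x => ?_
        rw [lintegral_const_mul _ (by fun_prop), lintegral_const_mul _ (by fun_prop),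
          Measure.volume_eq_prod, lintegral_prod_symm' _ (by fun_prop)]
    _ = ENNReal.ofReal R * ∫⁻ p, h p * ∫⁻ q, h q * (edist p q)⁻¹ := by
        rw [Measure.volume_eq_prod, ← lintegral_const_mul _ (by fun_prop),
          lintegral_prod_symm' _ (by fun_prop)]

end Energy

section Projection

/-- The points `p` such that the lines dual to `p` meet `U` for a set of slopes `l ∈ L` of measure
larger than `b` form an open set. -/
theorem isOpen_lt_lintegral_indicator_xray {U : Set (ℝ × ℝ)} (hU : IsOpen U) (L : Set ℝ)
    (b : ℝ≥0∞) :
    IsOpen {p : ℝ × ℝ | b < ∫⁻ l in L, U.indicator 1 (l, p.1 - l * p.2)} := by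
  have hmeas (p : ℝ × ℝ) : Measurable fun l : ℝ =>
      U.indicator (1 : ℝ × ℝ → ℝ≥0∞) (l, p.1 - l * p.2) :=
    (measurable_one.indicator hU.measurableSet).comp (by fun_prop)
  have hlsc : LowerSemicontinuous (U.indicator (1 : ℝ × ℝ → ℝ≥0∞)) :=
    hU.lowerSemicontinuous_indicator zero_le
  rw [← isClosed_compl_iff, ← isSeqClosed_iff_isClosed]
  intro u p hu hup
  simp only [mem_compl_iff, mem_ofPred_eq, not_lt] at hu ⊢
  calc ∫⁻ l in L, U.indicator 1 (l, p.1 - l * p.2)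
      ≤ ∫⁻ l in L, liminf (fun n => U.indicator 1 (l, (u n).1 - l * (u n).2)) atTop := by
        refine lintegral_mono fun l => ?_
        have hc : Tendsto (fun n => (l, (u n).1 - l * (u n).2)) atTop (𝓝 (l, p.1 - l * p.2)) :=
          ((by fun_prop : Continuous fun q : ℝ × ℝ => (l, q.1 - l * q.2)).tendsto p).comp hup
        refine le_of_forall_lt fun c hc' => ?_
        obtain ⟨d, hd, hd'⟩ := exists_between hc'
        exact hd.trans_le (le_liminf_of_le (by isBoundedDefault)
          ((hc.eventually (hlsc _ _ hd')).mono fun n hn => hn.le))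
    _ ≤ liminf (fun n => ∫⁻ l in L, U.indicator 1 (l, (u n).1 - l * (u n).2)) atTop :=
        lintegral_liminf_le fun n => hmeas (u n)
    _ ≤ b := (liminf_le_liminf (Eventually.of_forall hu)).trans_eq (by simp)

theorem lintegral_xray_duality (g : ℝ × ℝ → ℝ≥0∞) (hg : Measurable g) (F : ℝ × ℝ → ℝ≥0∞)
    (hF : Measurable F) (L : Set ℝ) :
    ∫⁻ p, g p * ∫⁻ l in L, F (l, p.1 - l * p.2) =
      ∫⁻ z : ℝ × ℝ, (F z * ∫⁻ y, g (z.2 + z.1 * y, y)) ∂(volume.restrict L).prod volume := by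
  calc ∫⁻ p, g p * ∫⁻ l in L, F (l, p.1 - l * p.2)
      = ∫⁻ p, ∫⁻ l in L, g p * F (l, p.1 - l * p.2) :=
        lintegral_congr fun p => (lintegral_const_mul _ (by fun_prop)).symm
    _ = ∫⁻ l in L, ∫⁻ p, g p * F (l, p.1 - l * p.2) := lintegral_lintegral_swap (by fun_prop)
    _ = ∫⁻ l in L, ∫⁻ y, ∫⁻ x, g (x, y) * F (l, x - l * y) := by
        refine lintegral_congr fun l => ?_
        rw [Measure.volume_eq_prod, lintegral_prod_symm' _ (by fun_prop)]
    _ = ∫⁻ l in L, ∫⁻ y, ∫⁻ t, g (t + l * y, y) * F (l, t) := by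
        refine lintegral_congr fun l => lintegral_congr fun y => ?_
        rw [← lintegral_add_right_eq_self _ (l * y)]
        simp only [add_sub_cancel_right]
    _ = ∫⁻ l in L, ∫⁻ t, F (l, t) * ∫⁻ y, g (t + l * y, y) := by
        refine lintegral_congr fun l => ?_
        rw [lintegral_lintegral_swap (by fun_prop)]
        refine lintegral_congr fun t => ?_
        rw [lintegral_mul_const _ (by fun_prop), mul_comm]
    _ = _ := (lintegral_prod (fun z : ℝ × ℝ => F z * ∫⁻ y, g (z.2 + z.1 * y, y))
        (by fun_prop)).symm

theorem frostmanMass_mul_sq_le {s : ℝ} {U : Set (ℝ × ℝ)} (hU : MeasurableSet U)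
    {L : Set ℝ} {R : ℝ} (hR : 1 ≤ R) (hL : L ⊆ Icc (-R) R) (b : ℝ≥0∞) (i : ℤ × ℤ) :
    frostmanMass volume dyadicIndex (fun n => ((2⁻¹ : ℝ≥0∞) ^ n) ^ s)
        {p : ℝ × ℝ | b < ∫⁻ l in L, U.indicator 1 (l, p.1 - l * p.2)} 0 i * b ^ 2 ≤
      volume U * (ENNReal.ofReal R * potentialBound s) := by
  simp only [frostmanMass, ENNReal.iSup_mul]
  refine iSup₂_le fun h hh => ?_
  set Q := dyadicIndex 0 ⁻¹' {i} with hQ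
  have hQm : MeasurableSet Q := measurableSet_dyadicIndex_preimage 0 i
  set g := Q.indicator h with hg
  have hgm : Measurable g := hh.1.indicator hQm
  set F : ℝ × ℝ → ℝ≥0∞ := U.indicator 1 with hF
  have hFm : Measurable F := measurable_one.indicator hU
  set I := ∫⁻ p in Q, h p with hI
  have hgI : ∫⁻ p, g p = I := lintegral_indicator hQm _
  have hItop : I ≠ ∞ := ((hh.2.2 0 i).trans_lt (by simp)).ne
  set μ := (volume.restrict L).prod (volume : Measure ℝ) with hμ
  set G : ℝ × ℝ → ℝ≥0∞ := fun z => ∫⁻ y, g (z.2 + z.1 * y, y) with hG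
  have hGm : Measurable G := by fun_prop
  have hlow : b * I ≤ ∫⁻ z, F z * G z ∂μ := by
    rw [← lintegral_xray_duality g hgm F hFm L, ← hgI, ← lintegral_const_mul _ hgm]
    refine lintegral_mono fun p => ?_
    by_cases hp : g p = 0
    · simp [hp]
    rw [mul_comm]
    gcongr
    by_contra hcon
    refine hp (indicator_apply_eq_zero.2 fun _ => hh.2.1 p fun hp' => hcon ?_)
    exact (show b < _ from hp').le
  have hF2 : ∫⁻ z, F z ^ (2 : ℝ) ∂μ ≤ volume U := by
    have : (fun z => F z ^ (2 : ℝ)) = F := by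
      funext z
      by_cases hz : z ∈ U <;> simp [hF, hz]
    rw [this, hF, lintegral_indicator_one hU, hμ, Measure.volume_eq_prod]
    exact Measure.prod_mono Measure.restrict_le_self le_rfl U
  have hG2 : ∫⁻ z, G z ^ (2 : ℝ) ∂μ ≤ ENNReal.ofReal R * potentialBound s * I := by
    simp only [ENNReal.rpow_two]
    rw [hμ, lintegral_prod _ (by fun_prop)]
    calc ∫⁻ l in L, ∫⁻ t, G (l, t) ^ 2 ≤ ∫⁻ l in Icc (-R) R, ∫⁻ t, G (l, t) ^ 2 :=
          lintegral_mono_set hL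
      _ ≤ ENNReal.ofReal R * ∫⁻ p, g p * ∫⁻ q, g q * (edist p q)⁻¹ :=
          lintegral_sq_xray_le g hgm hR
      _ ≤ ENNReal.ofReal R * ∫⁻ p, g p * potentialBound s := by
          refine mul_le_mul_right (lintegral_mono fun p => ?_) _
          by_cases hp : p ∈ Q
          · refine mul_le_mul_right (le_trans (le_of_eq ?_)
              (setLIntegral_mul_inv_edist_le hh (i := i) (p := p) hp)) _
            rw [← lintegral_indicator hQm]
            refine lintegral_congr fun q => ?_
            by_cases hq : q ∈ Q
            · simp only [hg, indicator_of_mem hq]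
            · simp only [hg, indicator_of_notMem hq, zero_mul]
          · simp [hg, hp]
      _ = ENNReal.ofReal R * potentialBound s * I := by
          rw [lintegral_mul_const _ hgm, hgI, mul_comm I, mul_assoc]
  have hCS : (b * I) ^ 2 ≤ volume U * (ENNReal.ofReal R * potentialBound s * I) := by
    have h1 := hlow.trans (ENNReal.lintegral_mul_le_Lp_mul_Lq μ Real.HolderConjugate.two_two
      hFm.aemeasurable hGm.aemeasurable)
    calc (b * I) ^ 2 ≤ ((∫⁻ z, F z ^ (2 : ℝ) ∂μ) ^ (1 / 2 : ℝ) *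
          (∫⁻ z, G z ^ (2 : ℝ) ∂μ) ^ (1 / 2 : ℝ)) ^ 2 := by gcongr
      _ = (∫⁻ z, F z ^ (2 : ℝ) ∂μ) * ∫⁻ z, G z ^ (2 : ℝ) ∂μ := by
        rw [mul_pow, ← ENNReal.rpow_two, ← ENNReal.rpow_two, ← ENNReal.rpow_mul,
          ← ENNReal.rpow_mul]
        norm_num
      _ ≤ _ := mul_le_mul' hF2 hG2
  rcases eq_or_ne I 0 with h0 | h0
  · simp [h0]
  refine (ENNReal.mul_le_mul_iff_left h0 hItop).1 (le_trans (le_of_eq ?_) (hCS.trans_eq ?_)) <;>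
    ring

theorem volume_slopes_eq_zero {s : ℝ} (hs : 1 < s) (hs2 : s ≤ 2) {E : Set (ℝ × ℝ)} {i : ℤ × ℤ}
    (hE : E ⊆ dyadicIndex 0 ⁻¹' {i}) (hE0 : Measure.hausdorffMeasure s E ≠ 0) {H : Set (ℝ × ℝ)}
    (hH : MeasurableSet H) {L : Set ℝ} (hL : MeasurableSet L) {R : ℝ} (hR : 1 ≤ R)
    (hLR : L ⊆ Icc (-R) R) (hLH : ∀ l ∈ L, volume (Prod.mk l ⁻¹' H) = 0)
    (hEH : ∀ p ∈ E, ∀ l ∈ L, (l, p.1 - l * p.2) ∈ H) : volume L = 0 := by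
  by_contra hL0
  have hLtop : volume L ≠ ∞ := ((measure_mono hLR).trans_lt measure_Icc_lt_top).ne
  set N := H ∩ L ×ˢ univ with hN
  have hN0 : volume N = 0 := by
    rw [Measure.volume_eq_prod, Measure.measure_prod_null (hH.inter (hL.prod MeasurableSet.univ))]
    refine Eventually.of_forall fun l => ?_
    by_cases hl : l ∈ L
    · exact measure_mono_null (preimage_mono inter_subset_left) (hLH l hl)
    · simp [hl]
  set b := volume L / 2 with hb
  have hb0 : b ≠ 0 := ENNReal.div_ne_zero.2 ⟨hL0, by simp⟩
  have hbt : b ≠ ∞ := ENNReal.div_ne_top hLtop (by simp)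
  set C := ENNReal.ofReal R * potentialBound s with hC
  have hCt : C ≠ ∞ := ENNReal.mul_ne_top (by simp) (potentialBound_ne_top hs)
  refine hE0 (hausdorffMeasure_eq_zero_of_frostmanMass_le (by linarith) hs2 hE fun ε hε => ?_)
  have hη : 0 < ε * b ^ 2 / C := ENNReal.div_pos (mul_ne_zero hε (pow_ne_zero 2 hb0)) hCt
  obtain ⟨U, hNU, hUo, hU⟩ := N.exists_isOpen_lt_of_lt _ (hN0.trans_lt hη)
  refine ⟨_, isOpen_lt_lintegral_indicator_xray hUo L b, fun p hp => ?_, ?_⟩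
  · have : ∫⁻ l in L, U.indicator (1 : ℝ × ℝ → ℝ≥0∞) (l, p.1 - l * p.2) = volume L := by
      rw [← setLIntegral_one]
      refine setLIntegral_congr_fun hL fun l hl => ?_
      exact indicator_of_mem (hNU ⟨hEH p hp l hl, hl, trivial⟩) _
    rw [mem_ofPred_eq, this]
    exact ENNReal.half_lt_self hL0 hLtop
  · have h1 := (frostmanMass_mul_sq_le (s := s) hUo.measurableSet hR hLR b i).trans
      (mul_le_mul_left hU.le C)
    have h2 : ε * b ^ 2 / C * C ≤ ε * b ^ 2 := ENNReal.mul_le_of_le_div le_rfl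
    exact (ENNReal.mul_le_mul_iff_left (pow_ne_zero 2 hb0) (ENNReal.pow_ne_top hbt)).1 (h1.trans h2)

/-- **Marstrand's projection theorem** for the projections `(x, y) ↦ x - l * y`. -/
theorem ae_volume_image_sub_mul_ne_zero {E : Set (ℝ × ℝ)} (hE : MeasurableSet E)
    (hdim : 1 < dimH E) :
    ∀ᵐ l : ℝ, volume ((fun p : ℝ × ℝ => p.1 - l * p.2) '' E) ≠ 0 := by
  have hcover : E = ⋃ i, E ∩ dyadicIndex 0 ⁻¹' {i} := by
    rw [← inter_iUnion, ← preimage_iUnion, iUnion_singleton_eq_range, range_id', preimage_univ,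
      inter_univ]
  rw [hcover, dimH_iUnion, lt_iSup_iff] at hdim
  obtain ⟨i, hi⟩ := hdim
  set E' := E ∩ dyadicIndex 0 ⁻¹' {i} with hE'
  have hE'm : MeasurableSet E' := hE.inter (measurableSet_dyadicIndex_preimage 0 i)
  obtain ⟨s, hs1, hs⟩ := ENNReal.lt_iff_exists_nnreal_btwn.1
    (lt_min hi (by norm_num : (1 : ℝ≥0∞) < 2))
  have hs1' : (1 : ℝ) < s := by exact_mod_cast hs1
  have hs2 : (s : ℝ) ≤ 2 := by exact_mod_cast (hs.trans_le (min_le_right _ _)).le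
  have hHs : Measure.hausdorffMeasure s E' ≠ 0 := by
    rw [hausdorffMeasure_of_lt_dimH (hs.trans_le (min_le_left _ _))]
    exact ENNReal.top_ne_zero
  let Z : Set (ℝ × ℝ) := (fun z : ℝ × ℝ × ℝ => (z.1, z.2.1 - z.1 * z.2.2)) '' (univ ×ˢ E')
  have hZ : NullMeasurableSet Z := by
    have : AnalyticSet Z :=
      (MeasurableSet.univ.prod hE'm).analyticSet.image_of_continuous (by fun_prop)
    exact (this.nullMeasurableSet (μ := (volume : Measure (ℝ × ℝ)).toFinite)).mono_ac
      (absolutelyContinuous_toFinite _)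
  obtain ⟨H, hZH, hH, hHZ⟩ := hZ.exists_measurable_superset_ae_eq
  have hslice : ∀ᵐ l : ℝ, ∀ᵐ t : ℝ, (l, t) ∈ H ↔ (l, t) ∈ Z := by
    refine Measure.ae_ae_of_ae_prod (p := fun z : ℝ × ℝ => z ∈ H ↔ z ∈ Z) ?_
    rw [← Measure.volume_eq_prod]
    exact hHZ.mem_iff
  have hbad : volume {l : ℝ | volume (Prod.mk l ⁻¹' H) = 0} = 0 := by
    set L : Set ℝ := {l : ℝ | volume (Prod.mk l ⁻¹' H) = 0} with hL
    have hLm : MeasurableSet L := measurable_measure_prodMk_left hH (measurableSet_singleton 0)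
    have hLU : L ⊆ ⋃ n : ℕ, L ∩ Icc (-((n : ℝ) + 1)) (n + 1) := fun l hl => by
      obtain ⟨n, hn⟩ := exists_nat_ge |l|
      exact mem_iUnion.2 ⟨n, hl, abs_le.1 (hn.trans (by linarith))⟩
    refine measure_mono_null hLU (measure_iUnion_null fun n => ?_)
    exact volume_slopes_eq_zero hs1' hs2 inter_subset_right hHs hH (hLm.inter measurableSet_Icc)
      (by linarith [n.cast_nonneg (α := ℝ)]) inter_subset_right (fun l hl => hl.1)
      fun p hp l _ => hZH ⟨(l, p), ⟨trivial, hp⟩, rfl⟩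
  have hgood : ∀ᵐ l : ℝ, volume (Prod.mk l ⁻¹' H) ≠ 0 := by
    rw [ae_iff]
    simpa using hbad
  filter_upwards [hslice, hgood] with l hl hl0 h0
  refine hl0 ?_
  rw [measure_congr (Filter.eventuallyEq_set.2 hl : Prod.mk l ⁻¹' H =ᵐ[volume] Prod.mk l ⁻¹' Z)]
  refine measure_mono_null ?_ h0
  rintro t ⟨⟨l', p⟩, ⟨-, hp⟩, heq⟩
  obtain ⟨rfl, rfl⟩ := Prod.ext_iff.1 heq
  exact ⟨p, hp.1, rfl⟩

end Projection

/-- If `A, B ⊆ ℝ` are Borel sets with `HD(A × B) > 1`, then for Lebesgue-almost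
every `λ ∈ ℝ` the set `A ⊖ λB = {x - λy : x ∈ A, y ∈ B}` has positive
one-dimensional Lebesgue outer measure; equivalently, for almost every `λ`,
the set of `t ∈ ℝ` with `A ∩ (λB + t) ≠ ∅` has positive Lebesgue outer
measure. -/
theorem arith_difference_pos_measure_of_dimH_prod_gt_one (A B : Set ℝ)
    (hA : MeasurableSet A) (hB : MeasurableSet B) (h : 1 < dimH (A ×ˢ B)) :
    ∀ᵐ l : ℝ ∂(volume : Measure ℝ),
      0 < volume {z : ℝ | ∃ x ∈ A, ∃ y ∈ B, z = x - l * y} ∧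
        0 < volume {t : ℝ | (A ∩ ((fun y : ℝ => l * y + t) '' B)).Nonempty} := by
  filter_upwards [ae_volume_image_sub_mul_ne_zero (hA.prod hB) h] with l hl
  refine ⟨(pos_iff_ne_zero.2 hl).trans_le (measure_mono ?_),
    (pos_iff_ne_zero.2 hl).trans_le (measure_mono ?_)⟩ <;>
  rintro _ ⟨⟨x, y⟩, ⟨hx, hy⟩, rfl⟩
  · exact ⟨x, hx, y, hy, rfl⟩
  · exact ⟨x, hx, y, hy, by ring⟩
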